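/- For every finite-dimensional A-module chain complex C, the maps 1+T, J, H are group homomorphisms and the sequence of abelian groups ⋯ → Q_n(C) →(1+T)→ Q^n(C) →(J)→ Q̂^n(C) →(H)→ Q_{n−1}(C) →(1+T)→ Q^{n−1}(C) → ⋯ is exact at every term (the kernel of each map equals the image of the preceding one). -/

import Mathlib

noncomputable section
open scoped Classical

/-- The sign `(-1)^k` for `k : ℤ`. -/
def esign (k : ℤ) : ℤ := (((-1 : ℤˣ) ^ k : ℤˣ) : ℤ)

variable {A : Type} [Ring A] [StarRing A]

/-- The dual of a left `A`-module, made into a left `A`-module using the involution: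
`(a • f) x = f x * star a`. -/
abbrev SDual (A : Type) [Ring A] [StarRing A] (M : Type) [AddCommGroup M] [Module A M] : Type :=
  M →ₗ[A] A

section SDualBasics

variable {M N : Type} [AddCommGroup M] [Module A M] [AddCommGroup N] [Module A N]

instance SDual.instSMul : SMul A (SDual A M) where
  smul a f :=
    { toFun := fun x => f x * star a
      map_add' := fun x y => by simp [add_mul]
      map_smul' := fun c x => by simp [mul_assoc] }

@[simp] theorem SDual.smul_apply (a : A) (f : SDual A M) (x : M) :
    (a • f) x = f x * star a := rfl

instance SDual.instModule : Module A (SDual A M) :=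
  Module.ofMinimalAxioms
    (fun a f g => by ext x; simp [add_mul])
    (fun a b f => by ext x; simp [star_add, mul_add])
    (fun a b f => by ext x; simp [star_mul, mul_assoc])
    (fun f => by ext x; simp)

/-- The dual of an `A`-linear map. -/
def sdualMap (f : M →ₗ[A] N) : SDual A N →ₗ[A] SDual A M where
  toFun g := g.comp f
  map_add' g h := rfl
  map_smul' a g := rfl

@[simp] theorem sdualMap_apply (f : M →ₗ[A] N) (g : SDual A N) (x : M) :
    sdualMap f g x = g (f x) := rfl

/-- The canonical evaluation map `M → M**`, `x ↦ (f ↦ star (f x))`. -/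
def sdualEval (A : Type) [Ring A] [StarRing A] (M : Type) [AddCommGroup M] [Module A M] :
    M →ₗ[A] SDual A (SDual A M) where
  toFun x :=
    { toFun := fun f => star (f x)
      map_add' := fun f g => by simp [star_add]
      map_smul' := fun a f => by simp [star_mul] }
  map_add' x y := by ext f; simp [star_add]
  map_smul' a x := by ext f; simp [star_mul]

end SDualBasics

/-- The underlying graded modules of a chain complex. -/
structure PreCx (A : Type) [Ring A] [StarRing A] : Type 1 where
  Mod : ℤ → Type
  acg : ∀ r, AddCommGroup (Mod r)
  mod : ∀ r, letI := acg r; Module A (Mod r)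

attribute [instance] PreCx.acg PreCx.mod

/-- A finite-dimensional chain complex of f.g. projective left `A`-modules,
together with (the automatically satisfied) reflexivity of the double duality map. -/
structure ChainCx (A : Type) [Ring A] [StarRing A] extends PreCx A : Type 1 where
  fg : ∀ r, Module.Finite A (Mod r)
  proj : ∀ r, Module.Projective A (Mod r)
  bdd : ∃ N : ℕ, ∀ r : ℤ, (N : ℤ) < |r| → Subsingleton (Mod r)
  d : ∀ r, Mod (r + 1) →ₗ[A] Mod r
  dd : ∀ r, (d r).comp (d (r + 1)) = 0
  refl : ∀ r, Function.Bijective (sdualEval A (Mod r))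

namespace ChainCx

variable (C : ChainCx A)

/-- Transport along an equality of degrees. -/
def cst : ∀ {r r' : ℤ}, r = r' → (C.Mod r →ₗ[A] C.Mod r')
  | _, _, rfl => LinearMap.id

/-- Transport of duals along an equality of degrees. -/
def dcst {r r' : ℤ} (h : r = r') : SDual A (C.Mod r) →ₗ[A] SDual A (C.Mod r') :=
  sdualMap (C.cst h.symm)

/-- The inverse of the double duality map. -/
def coev (r : ℤ) : SDual A (SDual A (C.Mod r)) →ₗ[A] C.Mod r :=
  (LinearEquiv.ofBijective (sdualEval A (C.Mod r)) (C.refl r)).symm.toLinearMap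

/-- The transposition `T` on maps `C^p → C_q`, using the identification `M** = M`. -/
def T (p q : ℤ) (θ : SDual A (C.Mod p) →ₗ[A] C.Mod q) :
    SDual A (C.Mod q) →ₗ[A] C.Mod p :=
  esign (p * q) • ((C.coev p).comp (sdualMap θ))

/-- The transposition `T` on maps `C_p → C^q`, using the identification `M** = M`. -/
def Tb (p q : ℤ) (θ : C.Mod p →ₗ[A] SDual A (C.Mod q)) :
    C.Mod q →ₗ[A] SDual A (C.Mod p) :=
  esign (p * q) • ((sdualMap θ).comp (sdualEval A (C.Mod q)))

/-- The dual differential `C^a → C^b` (where `b = a + 1`). -/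
def dstarTo {a b : ℤ} (h : b = a + 1) : SDual A (C.Mod a) →ₗ[A] SDual A (C.Mod b) :=
  sdualMap ((C.d a).comp (C.cst h))

end ChainCx

/-- The group of `n`-dimensional symmetric chains `{φ_s : C^{n-r+s} → C_r}`. -/
abbrev SymCh (C : ChainCx A) (n : ℤ) : Type :=
  ∀ (s : ℕ) (r : ℤ), SDual A (C.Mod (n - r + (s : ℤ))) →ₗ[A] C.Mod r

/-- The group of `n`-dimensional quadratic chains `{ψ_s : C^{n-r-s} → C_r}`. -/
abbrev QuadCh (C : ChainCx A) (n : ℤ) : Type :=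
  ∀ (s : ℕ) (r : ℤ), SDual A (C.Mod (n - r - (s : ℤ))) →ₗ[A] C.Mod r

/-- The group of `n`-dimensional hyperquadratic chains `{θ_s : C^{n-r+s} → C_r}, s ∈ ℤ`. -/
abbrev HypCh (C : ChainCx A) (n : ℤ) : Type :=
  ∀ (s : ℤ) (r : ℤ), SDual A (C.Mod (n - r + s)) →ₗ[A] C.Mod r

variable (C : ChainCx A)

/-- Reindexing of symmetric chains along an equality of dimensions. -/
def symCastDim {n n' : ℤ} (h : n = n') (φ : SymCh C n) : SymCh C n' := fun s r =>
  (φ s r).comp (C.dcst (show n' - r + (s : ℤ) = n - r + (s : ℤ) by rw [h]))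

/-- Reindexing of quadratic chains along an equality of dimensions. -/
def quadCastDim {n n' : ℤ} (h : n = n') (ψ : QuadCh C n) : QuadCh C n' := fun s r =>
  (ψ s r).comp (C.dcst (show n' - r - (s : ℤ) = n - r - (s : ℤ) by rw [h]))

/-- Reindexing of hyperquadratic chains along an equality of dimensions. -/
def hypCastDim {n n' : ℤ} (h : n = n') (θ : HypCh C n) : HypCh C n' := fun s r =>
  (θ s r).comp (C.dcst (show n' - r + s = n - r + s by rw [h]))

/-- The boundary of an `(n+1)`-dimensional symmetric chain:
`(dξ)_s = d ξ_s + (-1)^r ξ_s d* + (-1)^{n+s} (ξ_{s-1} + (-1)^s T ξ_{s-1})`. -/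
def symBnd (n : ℤ) (ξ : SymCh C (n + 1)) : SymCh C n
  | s, r =>
    (C.d r).comp ((ξ s (r + 1)).comp
        (C.dcst (show n - r + (s : ℤ) = n + 1 - (r + 1) + (s : ℤ) by ring)))
    + esign r • ((ξ s r).comp
        (C.dstarTo (show n + 1 - r + (s : ℤ) = (n - r + (s : ℤ)) + 1 by ring)))
    + (match s with
      | 0 => 0
      | (t + 1) =>
        esign (n + 1 + t) • (
          (ξ t r).comp (C.dcst (show n - r + ((t + 1 : ℕ) : ℤ) = n + 1 - r + (t : ℤ) by
            push_cast; ring))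
          + esign ((t : ℤ) + 1) •
            ((C.cst (show n + 1 - (n - r + ((t + 1 : ℕ) : ℤ)) + (t : ℤ) = r by push_cast; ring)).comp
              (C.T _ _ (ξ t (n - r + ((t + 1 : ℕ) : ℤ)))))))

/-- The boundary of an `(n+1)`-dimensional quadratic chain:
`(dχ)_s = d χ_s + (-1)^r χ_s d* + (-1)^{n-s} (χ_{s+1} + (-1)^{s+1} T χ_{s+1})`. -/
def quadBnd (n : ℤ) (χ : QuadCh C (n + 1)) : QuadCh C n := fun s r =>
  (C.d r).comp ((χ s (r + 1)).comp
      (C.dcst (show n - r - (s : ℤ) = n + 1 - (r + 1) - (s : ℤ) by ring)))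
  + esign r • ((χ s r).comp
      (C.dstarTo (show n + 1 - r - (s : ℤ) = (n - r - (s : ℤ)) + 1 by ring)))
  + esign (n - s) • (
      (χ (s + 1) r).comp (C.dcst (show n - r - (s : ℤ) = n + 1 - r - ((s + 1 : ℕ) : ℤ) by
        push_cast; ring))
      + esign ((s : ℤ) + 1) •
        ((C.cst (show n + 1 - (n - r - (s : ℤ)) - ((s + 1 : ℕ) : ℤ) = r by push_cast; ring)).comp
          (C.T _ _ (χ (s + 1) (n - r - (s : ℤ))))))

/-- The boundary of an `(n+1)`-dimensional hyperquadratic chain. -/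
def hypBnd (n : ℤ) (ν : HypCh C (n + 1)) : HypCh C n := fun s r =>
  (C.d r).comp ((ν s (r + 1)).comp
      (C.dcst (show n - r + s = n + 1 - (r + 1) + s by ring)))
  + esign r • ((ν s r).comp
      (C.dstarTo (show n + 1 - r + s = (n - r + s) + 1 by ring)))
  + esign (n + s) • (
      (ν (s - 1) r).comp (C.dcst (show n - r + s = n + 1 - r + (s - 1) by ring))
      + esign s •
        ((C.cst (show n + 1 - (n - r + s) + (s - 1) = r by ring)).comp
          (C.T _ _ (ν (s - 1) (n - r + s)))))

/-- `φ` is an `n`-dimensional symmetric structure on `C`. -/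
def IsSymStr (n : ℤ) (φ : SymCh C n) : Prop :=
  symBnd C (n - 1) (symCastDim C (show n = (n - 1) + 1 by ring) φ) = 0

/-- `ψ` is an `n`-dimensional quadratic structure on `C`. -/
def IsQuadStr (n : ℤ) (ψ : QuadCh C n) : Prop :=
  quadBnd C (n - 1) (quadCastDim C (show n = (n - 1) + 1 by ring) ψ) = 0

/-- `θ` is an `n`-dimensional hyperquadratic structure on `C`. -/
def IsHypStr (n : ℤ) (θ : HypCh C n) : Prop :=
  hypBnd C (n - 1) (hypCastDim C (show n = (n - 1) + 1 by ring) θ) = 0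

/-- The subgroup of `n`-dimensional symmetric structures (cycles). -/
def symCycles (n : ℤ) : AddSubgroup (SymCh C n) := AddSubgroup.closure {φ | IsSymStr C n φ}

/-- The subgroup of boundaries of symmetric chains. -/
def symBdrys (n : ℤ) : AddSubgroup (SymCh C n) := AddSubgroup.closure (Set.range (symBnd C n))

/-- The symmetric `Q`-group `Q^n(C)`. -/
def Qsym (n : ℤ) : Type := symCycles C n ⧸ ((symBdrys C n).addSubgroupOf (symCycles C n))

instance (n : ℤ) : AddCommGroup (Qsym C n) :=
  inferInstanceAs (AddCommGroup (_ ⧸ (_ : AddSubgroup _)))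

/-- The class of a symmetric structure in `Q^n(C)`. -/
def mkSym (n : ℤ) (φ : SymCh C n) (h : IsSymStr C n φ) : Qsym C n :=
  QuotientAddGroup.mk ⟨φ, AddSubgroup.subset_closure h⟩

def quadCycles (n : ℤ) : AddSubgroup (QuadCh C n) := AddSubgroup.closure {ψ | IsQuadStr C n ψ}

def quadBdrys (n : ℤ) : AddSubgroup (QuadCh C n) := AddSubgroup.closure (Set.range (quadBnd C n))

/-- The quadratic `Q`-group `Q_n(C)`. -/
def Qquad (n : ℤ) : Type := quadCycles C n ⧸ ((quadBdrys C n).addSubgroupOf (quadCycles C n))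

instance (n : ℤ) : AddCommGroup (Qquad C n) :=
  inferInstanceAs (AddCommGroup (_ ⧸ (_ : AddSubgroup _)))

def mkQuad (n : ℤ) (ψ : QuadCh C n) (h : IsQuadStr C n ψ) : Qquad C n :=
  QuotientAddGroup.mk ⟨ψ, AddSubgroup.subset_closure h⟩

def hypCycles (n : ℤ) : AddSubgroup (HypCh C n) := AddSubgroup.closure {θ | IsHypStr C n θ}

def hypBdrys (n : ℤ) : AddSubgroup (HypCh C n) := AddSubgroup.closure (Set.range (hypBnd C n))

/-- The hyperquadratic `Q`-group `Q̂^n(C)`. -/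
def Qhyp (n : ℤ) : Type := hypCycles C n ⧸ ((hypBdrys C n).addSubgroupOf (hypCycles C n))

instance (n : ℤ) : AddCommGroup (Qhyp C n) :=
  inferInstanceAs (AddCommGroup (_ ⧸ (_ : AddSubgroup _)))

def mkHyp (n : ℤ) (θ : HypCh C n) (h : IsHypStr C n θ) : Qhyp C n :=
  QuotientAddGroup.mk ⟨θ, AddSubgroup.subset_closure h⟩

/-- The symmetrization `(1+T)ψ` of a quadratic chain. -/
def oneTchain (n : ℤ) (ψ : QuadCh C n) : SymCh C n
  | 0, r =>
    (ψ 0 r).comp (C.dcst (show n - r + ((0 : ℕ) : ℤ) = n - r - ((0 : ℕ) : ℤ) by push_cast; ring))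
    + (C.cst (show n - (n - r + ((0 : ℕ) : ℤ)) - ((0 : ℕ) : ℤ) = r by push_cast; ring)).comp
        (C.T _ _ (ψ 0 (n - r + ((0 : ℕ) : ℤ))))
  | (_ + 1), _ => 0

/-- The map `J` from symmetric to hyperquadratic chains. -/
def Jchain (n : ℤ) (φ : SymCh C n) : HypCh C n := fun s r =>
  if h : 0 ≤ s then
    (φ s.toNat r).comp (C.dcst (by rw [Int.toNat_of_nonneg h]))
  else 0

/-- The map `H` from hyperquadratic to quadratic chains, `ψ_s = θ_{-s-1}`. -/
def Hchain (n : ℤ) (θ : HypCh C n) : QuadCh C (n - 1) := fun s r =>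
  (θ (-(s : ℤ) - 1) r).comp
    (C.dcst (show n - 1 - r - (s : ℤ) = n - r + (-(s : ℤ) - 1) by ring))

section Signs

theorem esign_add (a b : ℤ) : esign (a + b) = esign a * esign b := by
  simp [esign, zpow_add]

theorem esign_mul_self (a : ℤ) : esign a * esign a = 1 := by
  unfold esign
  rw [← Units.val_mul, Int.units_mul_self, Units.val_one]

theorem esign_zero : esign 0 = 1 := by simp [esign]

theorem esign_one : esign 1 = -1 := by simp [esign]

theorem esign_neg (a : ℤ) : esign (-a) = esign a := by
  simp [esign]

theorem esign_sub (a b : ℤ) : esign (a - b) = esign a * esign b := by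
  rw [sub_eq_add_neg, esign_add, esign_neg]

end Signs

/-! ### The algebraic complexes over a group with an involution and a differential -/

section Flat

variable {E : Type} [AddCommGroup E] (D T : E →+ E)

/-- The symmetric boundary on sequences. -/
def flatSymBnd (n : ℤ) : (ℕ → E) →+ (ℕ → E) :=
  AddMonoidHom.mk' (fun x s => D (x s) + match s with
      | 0 => 0
      | t + 1 => esign (n + 1 + t) • (x t + esign ((t : ℤ) + 1) • T (x t)))
    (fun x y => by
      funext s
      cases s <;> simp only [Pi.add_apply, map_add, smul_add] <;> abel)

/-- The quadratic boundary on sequences. -/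
def flatQuadBnd (n : ℤ) : (ℕ → E) →+ (ℕ → E) :=
  AddMonoidHom.mk' (fun x s => D (x s) +
      esign (n - s) • (x (s + 1) + esign ((s : ℤ) + 1) • T (x (s + 1))))
    (fun x y => by funext s; simp only [Pi.add_apply, map_add, smul_add]; abel)

/-- The hyperquadratic boundary on two-sided sequences. -/
def flatHypBnd (n : ℤ) : (ℤ → E) →+ (ℤ → E) :=
  AddMonoidHom.mk' (fun x s => D (x s) +
      esign (n + s) • (x (s - 1) + esign s • T (x (s - 1))))
    (fun x y => by funext s; simp only [Pi.add_apply, map_add, smul_add]; abel)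

/-- Symmetrization of a sequence. -/
def flatOneT : (ℕ → E) →+ (ℕ → E) :=
  AddMonoidHom.mk' (fun x s => match s with
      | 0 => x 0 + T (x 0)
      | _ + 1 => 0)
    (fun x y => by
      funext s
      cases s <;> simp only [Pi.add_apply, map_add, add_zero]
      abel)

variable (E) in
/-- Extension by zero to negative indices. -/
def flatJ : (ℕ → E) →+ (ℤ → E) :=
  AddMonoidHom.mk' (fun x s => if 0 ≤ s then x s.toNat else 0)
    (fun x y => by funext s; by_cases h : 0 ≤ s <;> simp [h])

variable (E) in
/-- The negative half of a two-sided sequence. -/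
def flatH : (ℤ → E) →+ (ℕ → E) :=
  AddMonoidHom.mk' (fun x s => x (-(s : ℤ) - 1)) (fun _ _ => rfl)

variable (E) in
/-- The nonnegative half of a two-sided sequence. -/
def flatR : (ℤ → E) →+ (ℕ → E) :=
  AddMonoidHom.mk' (fun x s => x s) (fun _ _ => rfl)

variable (E) in
/-- The section of `flatH` that extends by zero. -/
def flatK : (ℕ → E) →+ (ℤ → E) :=
  AddMonoidHom.mk' (fun x s => if 0 ≤ s then 0 else x (-s - 1).toNat)
    (fun x y => by funext s; by_cases h : 0 ≤ s <;> simp [h])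

theorem flatSymBnd_zero (n : ℤ) (x : ℕ → E) : flatSymBnd D T n x 0 = D (x 0) :=
  add_zero _

theorem flatSymBnd_succ (n : ℤ) (x : ℕ → E) (t : ℕ) :
    flatSymBnd D T n x (t + 1) =
      D (x (t + 1)) + esign (n + 1 + t) • (x t + esign ((t : ℤ) + 1) • T (x t)) := rfl

theorem flatQuadBnd_apply (n : ℤ) (x : ℕ → E) (s : ℕ) :
    flatQuadBnd D T n x s =
      D (x s) + esign (n - s) • (x (s + 1) + esign ((s : ℤ) + 1) • T (x (s + 1))) := rfl

theorem flatHypBnd_apply (n : ℤ) (x : ℤ → E) (s : ℤ) :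
    flatHypBnd D T n x s =
      D (x s) + esign (n + s) • (x (s - 1) + esign s • T (x (s - 1))) := rfl

theorem flatOneT_zero (x : ℕ → E) : flatOneT T x 0 = x 0 + T (x 0) := rfl

theorem flatOneT_succ (x : ℕ → E) (t : ℕ) : flatOneT T x (t + 1) = 0 := rfl

theorem flatJ_natCast (x : ℕ → E) (s : ℕ) : flatJ E x s = x s := by
  simp [flatJ]

theorem flatJ_neg (x : ℕ → E) (s : ℕ) : flatJ E x (-(s : ℤ) - 1) = 0 :=
  if_neg (by omega)

theorem flatK_natCast (x : ℕ → E) (s : ℕ) : flatK E x s = 0 := by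
  simp [flatK]

theorem flatK_neg (x : ℕ → E) (s : ℕ) : flatK E x (-(s : ℤ) - 1) = x s := by
  refine (if_neg (by omega)).trans (congrArg x (by omega))

theorem flatH_apply (x : ℤ → E) (s : ℕ) : flatH E x s = x (-(s : ℤ) - 1) := rfl

theorem flatR_apply (x : ℤ → E) (s : ℕ) : flatR E x s = x s := rfl

theorem flat_ext {x y : ℤ → E} (hR : flatR E x = flatR E y) (hH : flatH E x = flatH E y) :
    x = y := by
  funext s
  rcases Int.le_total 0 s with h | h
  · lift s to ℕ using h
    exact congrFun hR s
  · by_cases h0 : s = 0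
    · subst h0
      exact congrFun hR 0
    · obtain ⟨t, rfl⟩ : ∃ t : ℕ, s = -(t : ℤ) - 1 := ⟨(-s - 1).toNat, by omega⟩
      exact congrFun hH t

theorem flatR_J (x : ℕ → E) : flatR E (flatJ E x) = x := by
  funext s; rw [flatR_apply, flatJ_natCast]

theorem flatH_J (x : ℕ → E) : flatH E (flatJ E x) = 0 := by
  funext s; rw [flatH_apply, flatJ_neg]; rfl

theorem flatR_K (x : ℕ → E) : flatR E (flatK E x) = 0 := by
  funext s; rw [flatR_apply, flatK_natCast]; rfl

theorem flatH_K (x : ℕ → E) : flatH E (flatK E x) = x := by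
  funext s; rw [flatH_apply, flatK_neg]

theorem flatH_hypBnd (n : ℤ) (x : ℤ → E) :
    flatH E (flatHypBnd D T n x) = flatQuadBnd D T (n - 1) (flatH E x) := by
  funext s
  rw [flatH_apply, flatHypBnd_apply, flatQuadBnd_apply, flatH_apply, flatH_apply]
  rw [show -(s : ℤ) - 1 - 1 = -((s + 1 : ℕ) : ℤ) - 1 by push_cast; ring,
    show n + (-(s : ℤ) - 1) = n - 1 - s by ring,
    show -(s : ℤ) - 1 = -((s : ℤ) + 1) by ring, esign_neg]

theorem flatR_hypBnd (n : ℤ) (x : ℤ → E) :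
    flatR E (flatHypBnd D T n x) =
      flatSymBnd D T n (flatR E x) + esign n • flatOneT T (flatH E x) := by
  funext s
  rw [flatR_apply, flatHypBnd_apply, Pi.add_apply, Pi.smul_apply]
  cases s with
  | zero =>
    rw [flatSymBnd_zero, flatOneT_zero]
    simp [flatR_apply, flatH_apply, esign_zero]
  | succ t =>
    rw [flatSymBnd_succ, flatOneT_succ, flatR_apply, flatR_apply]
    rw [show ((t + 1 : ℕ) : ℤ) - 1 = t by push_cast; ring]
    push_cast
    rw [show n + ((t : ℤ) + 1) = n + 1 + t by ring, smul_zero, add_zero]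

theorem flatHypBnd_J (n : ℤ) (x : ℕ → E) :
    flatHypBnd D T n (flatJ E x) = flatJ E (flatSymBnd D T n x) := by
  apply flat_ext
  · rw [flatR_hypBnd, flatR_J, flatH_J, flatR_J, map_zero, smul_zero, add_zero]
  · rw [flatH_hypBnd, flatH_J, flatH_J, map_zero]

theorem flatHypBnd_K (n : ℤ) (x : ℕ → E) :
    flatHypBnd D T n (flatK E x) =
      flatK E (flatQuadBnd D T (n - 1) x) + esign n • flatJ E (flatOneT T x) := by
  apply flat_ext
  · simp only [flatR_hypBnd, flatR_K, flatH_K, map_add, map_zsmul, flatR_J, map_zero]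
  · simp only [flatH_hypBnd, flatH_K, map_add, map_zsmul, flatH_J, smul_zero, add_zero]

theorem flatJ_R_add_K_H (x : ℤ → E) : flatJ E (flatR E x) + flatK E (flatH E x) = x := by
  apply flat_ext
  · simp only [map_add, flatR_J, flatR_K, add_zero]
  · simp only [map_add, flatH_J, flatH_K, zero_add]

variable {D T}

theorem flatSymBnd_oneT (hT : ∀ x, T (T x) = x) (hDT : ∀ x, D (T x) = T (D x)) (n : ℤ) (x : ℕ → E) :
    flatSymBnd D T n (flatOneT T x) = flatOneT T (flatQuadBnd D T n x) := by
  funext s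
  match s with
  | 0 =>
    rw [flatSymBnd_zero, flatOneT_zero, flatOneT_zero, flatQuadBnd_apply]
    simp only [map_add, map_zsmul, hT, hDT, esign_one, Nat.cast_zero, zero_add]
    module
  | 1 =>
    rw [flatSymBnd_succ, flatOneT_zero, flatOneT_succ, flatOneT_succ]
    simp only [map_add, map_zero, hT, esign_one, Nat.cast_zero, zero_add]
    module
  | t + 2 =>
    rw [flatSymBnd_succ, flatOneT_succ, flatOneT_succ, flatOneT_succ]
    simp

theorem flatHypBnd_hypBnd (hD : ∀ x, D (D x) = 0) (hT : ∀ x, T (T x) = x)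
    (hDT : ∀ x, D (T x) = T (D x)) (n : ℤ) (x : ℤ → E) :
    flatHypBnd D T (n - 1) (flatHypBnd D T n x) = 0 := by
  funext s
  simp only [flatHypBnd_apply, map_add, map_zsmul, hT, hDT, hD, Pi.zero_apply]
  rw [show n - 1 + s = n + s - 1 by ring, show n + (s - 1) = n + s - 1 by ring,
    esign_sub (n + s), esign_sub s, esign_one]
  rcases mul_self_eq_one_iff.mp (esign_mul_self s) with h | h <;> rw [h] <;> module

end Flat

theorem LinearMap.comp_zsmul {R M N P : Type} [Ring R] [AddCommGroup M] [Module R M]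
    [AddCommGroup N] [Module R N] [AddCommGroup P] [Module R P] (k : ℤ)
    (f : M →ₗ[R] N) (g : N →ₗ[R] P) : g.comp (k • f) = k • g.comp f := by
  ext x
  simp

section Duality

variable {M N P : Type} [AddCommGroup M] [Module A M] [AddCommGroup N] [Module A N]
  [AddCommGroup P] [Module A P]

theorem sdualMap_add (f g : M →ₗ[A] N) : sdualMap (f + g) = sdualMap f + sdualMap g := by
  ext h x
  simp

theorem sdualMap_comp (f : M →ₗ[A] N) (g : N →ₗ[A] P) :
    sdualMap (g.comp f) = (sdualMap f).comp (sdualMap g) := rfl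

theorem sdualMap_zero : sdualMap (0 : M →ₗ[A] N) = 0 := by
  ext h x
  simp

theorem sdualMap_zsmul (k : ℤ) (f : M →ₗ[A] N) : sdualMap (k • f) = k • sdualMap f := by
  ext h x
  simp

end Duality

namespace ChainCx

theorem sdualEval_coev (r : ℤ) (y : SDual A (SDual A (C.Mod r))) :
    sdualEval A (C.Mod r) (C.coev r y) = y :=
  (LinearEquiv.ofBijective (sdualEval A (C.Mod r)) (C.refl r)).apply_symm_apply y

theorem star_apply_coev (r : ℤ) (y : SDual A (SDual A (C.Mod r))) (f : SDual A (C.Mod r)) :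
    star (f (C.coev r y)) = y f :=
  congrArg (fun z => z f) (C.sdualEval_coev r y)

theorem coev_eq_iff (r : ℤ) (y : SDual A (SDual A (C.Mod r))) (x : C.Mod r) :
    C.coev r y = x ↔ ∀ f : SDual A (C.Mod r), star (f x) = y f := by
  constructor
  · rintro rfl f
    exact C.star_apply_coev r y f
  · intro h
    apply (C.refl r).1
    rw [sdualEval_coev]
    ext f
    exact (h f).symm

theorem coev_comp_sdualMap_sdualMap {p q : ℤ} (f : C.Mod p →ₗ[A] C.Mod q) :
    (C.coev q).comp (sdualMap (sdualMap f)) = f.comp (C.coev p) := by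
  ext y
  refine (C.coev_eq_iff _ _ _).2 fun g => ?_
  exact C.star_apply_coev p y (sdualMap f g)

theorem T_add (p q : ℤ) (θ η : SDual A (C.Mod p) →ₗ[A] C.Mod q) :
    C.T p q (θ + η) = C.T p q θ + C.T p q η := by
  rw [T, T, T, sdualMap_add, LinearMap.comp_add, smul_add]

theorem T_zsmul (p q k : ℤ) (θ : SDual A (C.Mod p) →ₗ[A] C.Mod q) :
    C.T p q (k • θ) = k • C.T p q θ := by
  rw [T, T, sdualMap_zsmul, LinearMap.comp_zsmul, smul_comm]

theorem T_zero (p q : ℤ) : C.T p q 0 = 0 := by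
  rw [T, sdualMap_zero, LinearMap.comp_zero, smul_zero]

theorem coev_coev (p q : ℤ) (θ : SDual A (C.Mod p) →ₗ[A] C.Mod q) :
    (C.coev q).comp (sdualMap ((C.coev p).comp (sdualMap θ))) = θ := by
  ext f
  refine (C.coev_eq_iff _ _ _).2 fun g => ?_
  rw [sdualMap_apply, LinearMap.comp_apply, ← star_star (f _), star_apply_coev]
  rfl

theorem T_T (p q : ℤ) (θ : SDual A (C.Mod p) →ₗ[A] C.Mod q) :
    C.T q p (C.T p q θ) = θ := by
  rw [T, T, sdualMap_zsmul, LinearMap.comp_zsmul, smul_smul, coev_coev, mul_comm q p,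
    esign_mul_self, one_smul]

/-- All morphisms `C^p → C_q`. -/
abbrev Bigraded : Type := ∀ p q : ℤ, SDual A (C.Mod p) →ₗ[A] C.Mod q

/-- The total differential `d θ + (-1)^q θ d*`. -/
def totalD : C.Bigraded →+ C.Bigraded :=
  AddMonoidHom.mk' (fun θ p q => (C.d q).comp (θ p (q + 1)) +
      esign q • (θ (p + 1) q).comp (sdualMap (C.d p)))
    (fun θ η => by
      funext p q
      simp only [Pi.add_apply, LinearMap.comp_add, LinearMap.add_comp, smul_add]
      abel)

/-- The total transposition. -/
def totalT : C.Bigraded →+ C.Bigraded :=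
  AddMonoidHom.mk' (fun θ p q => C.T q p (θ q p))
    (fun θ η => by funext p q; exact C.T_add _ _ _ _)

theorem totalD_apply (θ : C.Bigraded) (p q : ℤ) :
    C.totalD θ p q = (C.d q).comp (θ p (q + 1)) +
      esign q • (θ (p + 1) q).comp (sdualMap (C.d p)) := rfl

theorem totalT_apply (θ : C.Bigraded) (p q : ℤ) : C.totalT θ p q = C.T q p (θ q p) := rfl

theorem totalT_totalT (θ : C.Bigraded) : C.totalT (C.totalT θ) = θ := by
  funext p q
  exact C.T_T p q _

theorem totalD_totalD (θ : C.Bigraded) : C.totalD (C.totalD θ) = 0 := by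
  funext p q
  have h1 (η : SDual A (C.Mod p) →ₗ[A] C.Mod (q + 1 + 1)) :
      (C.d q).comp ((C.d (q + 1)).comp η) = 0 := by
    rw [← LinearMap.comp_assoc, C.dd, LinearMap.zero_comp]
  have h2 (η : SDual A (C.Mod (p + 1 + 1)) →ₗ[A] C.Mod q) :
      (η.comp (sdualMap (C.d (p + 1)))).comp (sdualMap (C.d p)) = 0 := by
    rw [LinearMap.comp_assoc, ← sdualMap_comp, C.dd, sdualMap_zero, LinearMap.comp_zero]
  simp only [totalD_apply, LinearMap.comp_add, LinearMap.add_comp, LinearMap.comp_zsmul,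
    LinearMap.smul_comp, h1, h2, esign_add, esign_one, LinearMap.comp_assoc, Pi.zero_apply]
  module

theorem totalD_totalT (θ : C.Bigraded) : C.totalD (C.totalT θ) = C.totalT (C.totalD θ) := by
  funext p q
  simp only [totalD_apply, totalT_apply, T_add, T_zsmul]
  have h1 : C.T q p ((C.d p).comp (θ q (p + 1))) =
      esign q • (C.T q (p + 1) (θ q (p + 1))).comp (sdualMap (C.d p)) := by
    rw [T, T, sdualMap_comp, LinearMap.smul_comp, smul_smul, mul_add, mul_one, esign_add,
      mul_comm (esign (q * p)), ← mul_assoc, esign_mul_self, one_mul, LinearMap.comp_assoc]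
  have h2 : C.T q p ((θ (q + 1) p).comp (sdualMap (C.d q))) =
      esign p • (C.d q).comp (C.T (q + 1) p (θ (q + 1) p)) := by
    rw [T, T, sdualMap_comp, LinearMap.comp_zsmul, smul_smul, add_mul, one_mul, esign_add,
      mul_comm (esign (q * p)), ← mul_assoc, esign_mul_self, one_mul, ← LinearMap.comp_assoc,
      coev_comp_sdualMap_sdualMap, LinearMap.comp_assoc]
  rw [h1, h2, smul_smul, esign_mul_self, one_smul, add_comm]

/-- A single morphism `C^a → C_q`, extended by zero to all degrees of the source. -/
def extend {a q : ℤ} (θ : SDual A (C.Mod a) →ₗ[A] C.Mod q) (p : ℤ) :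
    SDual A (C.Mod p) →ₗ[A] C.Mod q :=
  if h : p = a then θ.comp (C.dcst h) else 0

theorem comp_dcst {a p q : ℤ} (θ : SDual A (C.Mod a) →ₗ[A] C.Mod q) (h : p = a) :
    θ.comp (C.dcst h) = C.extend θ p := by
  rw [extend, dif_pos h]

theorem extend_self {a q : ℤ} (θ : SDual A (C.Mod a) →ₗ[A] C.Mod q) : C.extend θ a = θ :=
  (C.comp_dcst θ rfl).symm

theorem extend_of_ne {a p q : ℤ} (θ : SDual A (C.Mod a) →ₗ[A] C.Mod q) (h : p ≠ a) :
    C.extend θ p = 0 := dif_neg h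

theorem extend_add {a q : ℤ} (θ η : SDual A (C.Mod a) →ₗ[A] C.Mod q) (p : ℤ) :
    C.extend (θ + η) p = C.extend θ p + C.extend η p := by
  by_cases h : p = a
  · subst h
    simp only [extend_self]
  · simp only [C.extend_of_ne _ h, add_zero]

theorem extend_comp_dcst {a b q : ℤ} (θ : SDual A (C.Mod a) →ₗ[A] C.Mod q) (h : b = a) (p : ℤ) :
    C.extend (θ.comp (C.dcst h)) p = C.extend θ p := by
  subst h
  rfl

theorem comp_dstarTo {a p q : ℤ} (θ : SDual A (C.Mod a) →ₗ[A] C.Mod q) (h : a = p + 1) :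
    θ.comp (C.dstarTo h) = (C.extend θ (p + 1)).comp (sdualMap (C.d p)) := by
  subst h
  rw [extend_self]
  rfl

theorem cst_comp_T {a b q : ℤ} (θ : SDual A (C.Mod a) →ₗ[A] C.Mod b) (h : a = q) :
    (C.cst h).comp (C.T a b θ) = C.T q b (C.extend θ q) := by
  subst h
  rw [extend_self]
  rfl

end ChainCx

open ChainCx

/-- A symmetric chain as a sequence of bigraded morphisms. -/
def symFlat (n : ℤ) : SymCh C n →+ (ℕ → C.Bigraded) :=
  AddMonoidHom.mk' (fun φ s p q => C.extend (φ s q) p)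
    (fun _ _ => by funext s p q; exact C.extend_add _ _ _)

/-- A quadratic chain as a sequence of bigraded morphisms. -/
def quadFlat (n : ℤ) : QuadCh C n →+ (ℕ → C.Bigraded) :=
  AddMonoidHom.mk' (fun φ s p q => C.extend (φ s q) p)
    (fun _ _ => by funext s p q; exact C.extend_add _ _ _)

/-- A hyperquadratic chain as a two-sided sequence of bigraded morphisms. -/
def hypFlat (n : ℤ) : HypCh C n →+ (ℤ → C.Bigraded) :=
  AddMonoidHom.mk' (fun φ s p q => C.extend (φ s q) p)
    (fun _ _ => by funext s p q; exact C.extend_add _ _ _)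

theorem symFlat_apply (n : ℤ) (φ : SymCh C n) (s : ℕ) (p q : ℤ) :
    symFlat C n φ s p q = C.extend (φ s q) p := rfl

theorem quadFlat_apply (n : ℤ) (φ : QuadCh C n) (s : ℕ) (p q : ℤ) :
    quadFlat C n φ s p q = C.extend (φ s q) p := rfl

theorem hypFlat_apply (n : ℤ) (φ : HypCh C n) (s p q : ℤ) :
    hypFlat C n φ s p q = C.extend (φ s q) p := rfl

theorem symFlat_injective (n : ℤ) : Function.Injective (symFlat C n) := fun φ ψ h => by
  funext s r
  simpa only [symFlat_apply, extend_self] using congrFun (congrFun (congrFun h s) (n - r + s)) r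

theorem quadFlat_injective (n : ℤ) : Function.Injective (quadFlat C n) := fun φ ψ h => by
  funext s r
  simpa only [quadFlat_apply, extend_self] using congrFun (congrFun (congrFun h s) (n - r - s)) r

theorem hypFlat_injective (n : ℤ) : Function.Injective (hypFlat C n) := fun φ ψ h => by
  funext s r
  simpa only [hypFlat_apply, extend_self] using congrFun (congrFun (congrFun h s) (n - r + s)) r

theorem symFlat_castDim {n n' : ℤ} (h : n = n') (φ : SymCh C n) :
    symFlat C n' (symCastDim C h φ) = symFlat C n φ := by
  subst h
  rfl

theorem quadFlat_castDim {n n' : ℤ} (h : n = n') (φ : QuadCh C n) :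
    quadFlat C n' (quadCastDim C h φ) = quadFlat C n φ := by
  subst h
  rfl

theorem hypFlat_castDim {n n' : ℤ} (h : n = n') (φ : HypCh C n) :
    hypFlat C n' (hypCastDim C h φ) = hypFlat C n φ := by
  subst h
  rfl

theorem symFlat_symBnd (n : ℤ) (ξ : SymCh C (n + 1)) :
    symFlat C n (symBnd C n ξ) =
      flatSymBnd C.totalD C.totalT n (symFlat C (n + 1) ξ) := by
  funext s p q
  rw [symFlat_apply]
  by_cases h : p = n - q + s
  · subst h
    rw [extend_self]
    cases s with
    | zero =>
      rw [flatSymBnd_zero, totalD_apply, symFlat_apply, symFlat_apply, symBnd,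
        C.comp_dstarTo, C.comp_dcst]
      exact add_zero _
    | succ t =>
      rw [flatSymBnd_succ, Pi.add_apply, Pi.add_apply, Pi.smul_apply, Pi.smul_apply,
        Pi.add_apply, Pi.add_apply, Pi.smul_apply, Pi.smul_apply, totalD_apply, totalT_apply]
      simp only [symFlat_apply, symBnd, C.comp_dstarTo, C.comp_dcst, C.cst_comp_T]
  · rw [C.extend_of_ne _ h]
    cases s with
    | zero =>
      rw [flatSymBnd_zero, totalD_apply, symFlat_apply, symFlat_apply,
        C.extend_of_ne _ (by omega), C.extend_of_ne _ (by omega)]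
      simp
    | succ t =>
      rw [flatSymBnd_succ, Pi.add_apply, Pi.add_apply, Pi.smul_apply, Pi.smul_apply,
        Pi.add_apply, Pi.add_apply, Pi.smul_apply, Pi.smul_apply, totalD_apply, totalT_apply]
      simp only [symFlat_apply]
      rw [C.extend_of_ne _ (by omega), C.extend_of_ne _ (by omega), C.extend_of_ne _ (by omega),
        C.extend_of_ne _ (by omega)]
      simp [T_zero]

theorem quadFlat_quadBnd (n : ℤ) (ξ : QuadCh C (n + 1)) :
    quadFlat C n (quadBnd C n ξ) =
      flatQuadBnd C.totalD C.totalT n (quadFlat C (n + 1) ξ) := by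
  funext s p q
  rw [quadFlat_apply, flatQuadBnd_apply, Pi.add_apply, Pi.add_apply, Pi.smul_apply, Pi.smul_apply,
    Pi.add_apply, Pi.add_apply, Pi.smul_apply, Pi.smul_apply, totalD_apply, totalT_apply]
  simp only [quadFlat_apply]
  by_cases h : p = n - q - s
  · subst h
    simp only [extend_self, quadBnd, C.comp_dstarTo, C.comp_dcst, C.cst_comp_T]
  · rw [C.extend_of_ne _ h, C.extend_of_ne _ (by omega), C.extend_of_ne _ (by omega),
      C.extend_of_ne _ (by omega), C.extend_of_ne _ (by omega)]
    simp [T_zero]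

theorem hypFlat_hypBnd (n : ℤ) (ξ : HypCh C (n + 1)) :
    hypFlat C n (hypBnd C n ξ) =
      flatHypBnd C.totalD C.totalT n (hypFlat C (n + 1) ξ) := by
  funext s p q
  rw [hypFlat_apply, flatHypBnd_apply, Pi.add_apply, Pi.add_apply, Pi.smul_apply, Pi.smul_apply,
    Pi.add_apply, Pi.add_apply, Pi.smul_apply, Pi.smul_apply, totalD_apply, totalT_apply]
  simp only [hypFlat_apply]
  by_cases h : p = n - q + s
  · subst h
    simp only [extend_self, hypBnd, C.comp_dstarTo, C.comp_dcst, C.cst_comp_T]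
  · rw [C.extend_of_ne _ h, C.extend_of_ne _ (by omega), C.extend_of_ne _ (by omega),
      C.extend_of_ne _ (by omega), C.extend_of_ne _ (by omega)]
    simp [T_zero]

theorem symFlat_oneTchain (n : ℤ) (ψ : QuadCh C n) :
    symFlat C n (oneTchain C n ψ) = flatOneT C.totalT (quadFlat C n ψ) := by
  funext s p q
  rw [symFlat_apply]
  cases s with
  | zero =>
    rw [flatOneT_zero, Pi.add_apply, Pi.add_apply, totalT_apply, quadFlat_apply, quadFlat_apply]
    by_cases h : p = n - q + ((0 : ℕ) : ℤ)
    · subst h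
      simp only [extend_self, oneTchain, C.comp_dcst, C.cst_comp_T]
    · rw [C.extend_of_ne _ h, C.extend_of_ne _ (by omega), C.extend_of_ne _ (by omega), T_zero,
        add_zero]
  | succ t =>
    rw [flatOneT_succ]
    by_cases h : p = n - q + ((t + 1 : ℕ) : ℤ)
    · subst h
      rw [extend_self]
      rfl
    · rw [C.extend_of_ne _ h]
      rfl

theorem hypFlat_Jchain (n : ℤ) (φ : SymCh C n) :
    hypFlat C n (Jchain C n φ) = flatJ C.Bigraded (symFlat C n φ) := by
  apply flat_ext
  · rw [flatR_J]
    funext s p q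
    rw [flatR_apply, hypFlat_apply, symFlat_apply, Jchain, dif_pos (by omega),
      C.extend_comp_dcst, Int.toNat_natCast]
  · rw [flatH_J]
    funext s p q
    rw [flatH_apply, hypFlat_apply, Jchain, dif_neg (by omega)]
    by_cases h : p = n - q + (-(s : ℤ) - 1)
    · subst h
      rw [extend_self]
      rfl
    · exact C.extend_of_ne _ h

theorem quadFlat_Hchain (n : ℤ) (θ : HypCh C n) :
    quadFlat C (n - 1) (Hchain C n θ) = flatH C.Bigraded (hypFlat C n θ) := by
  funext s p q
  exact C.extend_comp_dcst _ _ _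

/-! ### Cycles and boundaries -/

theorem exists_symFlat_eq {n : ℤ} {x : ℕ → C.Bigraded}
    (hx : ∀ (s : ℕ) (p q : ℤ), p ≠ n - q + s → x s p q = 0) : ∃ φ, symFlat C n φ = x := by
  refine ⟨fun s r => x s (n - r + s) r, ?_⟩
  funext s p q
  rw [symFlat_apply]
  by_cases h : p = n - q + s
  · subst h
    exact C.extend_self _
  · rw [C.extend_of_ne _ h, hx s p q h]

theorem exists_hypFlat_eq {n : ℤ} {x : ℤ → C.Bigraded}
    (hx : ∀ s p q, p ≠ n - q + s → x s p q = 0) : ∃ θ, hypFlat C n θ = x := by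
  refine ⟨fun s r => x s (n - r + s) r, ?_⟩
  funext s p q
  rw [hypFlat_apply]
  by_cases h : p = n - q + s
  · subst h
    exact C.extend_self _
  · rw [C.extend_of_ne _ h, hx s p q h]

theorem exists_hypFlat_eq_flatK {n m : ℤ} (hm : m = n + 1) (ψ : QuadCh C n) :
    ∃ θ, hypFlat C m θ = flatK C.Bigraded (quadFlat C n ψ) := by
  refine exists_hypFlat_eq C fun s p q h => ?_
  rcases Int.lt_or_le s 0 with hs | hs
  · obtain ⟨t, rfl⟩ : ∃ t : ℕ, s = -(t : ℤ) - 1 := ⟨(-s - 1).toNat, by omega⟩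
    rw [flatK_neg]
    exact C.extend_of_ne _ (by omega)
  · lift s to ℕ using hs
    rw [flatK_natCast]
    rfl

theorem exists_symFlat_eq_flatR {n : ℤ} (θ : HypCh C n) :
    ∃ φ, symFlat C n φ = flatR C.Bigraded (hypFlat C n θ) :=
  exists_symFlat_eq C fun _ _ _ h => C.extend_of_ne _ h

theorem exists_quadFlat_eq_flatH {n m : ℤ} (hm : m = n + 1) (θ : HypCh C m) :
    ∃ ψ, quadFlat C n ψ = flatH C.Bigraded (hypFlat C m θ) :=
  ⟨quadCastDim C (by omega) (Hchain C m θ), by rw [quadFlat_castDim, quadFlat_Hchain]⟩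

theorem isSymStr_iff (n : ℤ) (φ : SymCh C n) :
    IsSymStr C n φ ↔ flatSymBnd C.totalD C.totalT (n - 1) (symFlat C n φ) = 0 := by
  rw [IsSymStr, ← (symFlat_injective C _).eq_iff, symFlat_symBnd, symFlat_castDim, map_zero]

theorem isQuadStr_iff (n : ℤ) (ψ : QuadCh C n) :
    IsQuadStr C n ψ ↔ flatQuadBnd C.totalD C.totalT (n - 1) (quadFlat C n ψ) = 0 := by
  rw [IsQuadStr, ← (quadFlat_injective C _).eq_iff, quadFlat_quadBnd, quadFlat_castDim, map_zero]

theorem isHypStr_iff (n : ℤ) (θ : HypCh C n) :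
    IsHypStr C n θ ↔ flatHypBnd C.totalD C.totalT (n - 1) (hypFlat C n θ) = 0 := by
  rw [IsHypStr, ← (hypFlat_injective C _).eq_iff, hypFlat_hypBnd, hypFlat_castDim, map_zero]

theorem mem_symCycles {n : ℤ} {φ : SymCh C n} : φ ∈ symCycles C n ↔
    flatSymBnd C.totalD C.totalT (n - 1) (symFlat C n φ) = 0 := by
  have h : {φ | IsSymStr C n φ} =
      (((flatSymBnd C.totalD C.totalT (n - 1)).comp (symFlat C n)).ker : Set (SymCh C n)) :=
    Set.ext (isSymStr_iff C n)
  rw [symCycles, h, AddSubgroup.closure_eq]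
  rfl

theorem mem_quadCycles {n : ℤ} {ψ : QuadCh C n} : ψ ∈ quadCycles C n ↔
    flatQuadBnd C.totalD C.totalT (n - 1) (quadFlat C n ψ) = 0 := by
  have h : {ψ | IsQuadStr C n ψ} =
      (((flatQuadBnd C.totalD C.totalT (n - 1)).comp (quadFlat C n)).ker : Set (QuadCh C n)) :=
    Set.ext (isQuadStr_iff C n)
  rw [quadCycles, h, AddSubgroup.closure_eq]
  rfl

theorem mem_hypCycles {n : ℤ} {θ : HypCh C n} : θ ∈ hypCycles C n ↔
    flatHypBnd C.totalD C.totalT (n - 1) (hypFlat C n θ) = 0 := by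
  have h : {θ | IsHypStr C n θ} =
      (((flatHypBnd C.totalD C.totalT (n - 1)).comp (hypFlat C n)).ker : Set (HypCh C n)) :=
    Set.ext (isHypStr_iff C n)
  rw [hypCycles, h, AddSubgroup.closure_eq]
  rfl

theorem mem_symBdrys {n m : ℤ} (hm : m = n + 1) {φ : SymCh C n} : φ ∈ symBdrys C n ↔
    ∃ ξ : SymCh C m, flatSymBnd C.totalD C.totalT n (symFlat C m ξ) = symFlat C n φ := by
  subst hm
  let b : SymCh C (n + 1) →+ SymCh C n := AddMonoidHom.mk' (symBnd C n) fun ξ η =>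
    symFlat_injective C n (by simp only [map_add, symFlat_symBnd])
  rw [symBdrys, show Set.range (symBnd C n) = (b.range : Set (SymCh C n)) from rfl,
    AddSubgroup.closure_eq, AddMonoidHom.mem_range]
  refine exists_congr fun ξ => ?_
  rw [← (symFlat_injective C n).eq_iff, ← symFlat_symBnd]
  rfl

theorem mem_quadBdrys {n m : ℤ} (hm : m = n + 1) {ψ : QuadCh C n} : ψ ∈ quadBdrys C n ↔
    ∃ χ : QuadCh C m, flatQuadBnd C.totalD C.totalT n (quadFlat C m χ) = quadFlat C n ψ := by
  subst hm
  let b : QuadCh C (n + 1) →+ QuadCh C n := AddMonoidHom.mk' (quadBnd C n) fun ξ η =>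
    quadFlat_injective C n (by simp only [map_add, quadFlat_quadBnd])
  rw [quadBdrys, show Set.range (quadBnd C n) = (b.range : Set (QuadCh C n)) from rfl,
    AddSubgroup.closure_eq, AddMonoidHom.mem_range]
  refine exists_congr fun χ => ?_
  rw [← (quadFlat_injective C n).eq_iff, ← quadFlat_quadBnd]
  rfl

theorem mem_hypBdrys {n m : ℤ} (hm : m = n + 1) {θ : HypCh C n} : θ ∈ hypBdrys C n ↔
    ∃ ν : HypCh C m, flatHypBnd C.totalD C.totalT n (hypFlat C m ν) = hypFlat C n θ := by
  subst hm
  let b : HypCh C (n + 1) →+ HypCh C n := AddMonoidHom.mk' (hypBnd C n) fun ξ η =>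
    hypFlat_injective C n (by simp only [map_add, hypFlat_hypBnd])
  rw [hypBdrys, show Set.range (hypBnd C n) = (b.range : Set (HypCh C n)) from rfl,
    AddSubgroup.closure_eq, AddMonoidHom.mem_range]
  refine exists_congr fun ν => ?_
  rw [← (hypFlat_injective C n).eq_iff, ← hypFlat_hypBnd]
  rfl

/-- Symmetrization as a homomorphism of chain groups. -/
def oneTHom (n : ℤ) : QuadCh C n →+ SymCh C n :=
  AddMonoidHom.mk' (oneTchain C n) fun ψ χ =>
    symFlat_injective C n (by simp only [map_add, symFlat_oneTchain])

/-- The map `J` as a homomorphism of chain groups. -/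
def JHom (n : ℤ) : SymCh C n →+ HypCh C n :=
  AddMonoidHom.mk' (Jchain C n) fun φ ξ =>
    hypFlat_injective C n (by simp only [map_add, hypFlat_Jchain])

/-- The map `H` as a homomorphism of chain groups. -/
def HHom (n : ℤ) : HypCh C n →+ QuadCh C (n - 1) :=
  AddMonoidHom.mk' (Hchain C n) fun θ ν =>
    quadFlat_injective C (n - 1) (by simp only [map_add, quadFlat_Hchain])

theorem symFlat_oneTHom (n : ℤ) (ψ : QuadCh C n) :
    symFlat C n (oneTHom C n ψ) = flatOneT C.totalT (quadFlat C n ψ) :=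
  symFlat_oneTchain C n ψ

theorem hypFlat_JHom (n : ℤ) (φ : SymCh C n) :
    hypFlat C n (JHom C n φ) = flatJ C.Bigraded (symFlat C n φ) :=
  hypFlat_Jchain C n φ

theorem quadFlat_HHom (n : ℤ) (θ : HypCh C n) :
    quadFlat C (n - 1) (HHom C n θ) = flatH C.Bigraded (hypFlat C n θ) :=
  quadFlat_Hchain C n θ

theorem oneTHom_mem_cycles {n : ℤ} {ψ : QuadCh C n} (h : ψ ∈ quadCycles C n) :
    oneTHom C n ψ ∈ symCycles C n := by
  rw [mem_quadCycles] at h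
  rw [mem_symCycles, symFlat_oneTHom, flatSymBnd_oneT C.totalT_totalT C.totalD_totalT, h, map_zero]

theorem oneTHom_mem_bdrys {n : ℤ} {ψ : QuadCh C n} (h : ψ ∈ quadBdrys C n) :
    oneTHom C n ψ ∈ symBdrys C n := by
  obtain ⟨χ, hχ⟩ := (mem_quadBdrys C rfl).1 h
  refine (mem_symBdrys C rfl).2 ⟨oneTHom C _ χ, ?_⟩
  rw [symFlat_oneTHom, symFlat_oneTHom, flatSymBnd_oneT C.totalT_totalT C.totalD_totalT, hχ]

theorem JHom_mem_cycles {n : ℤ} {φ : SymCh C n} (h : φ ∈ symCycles C n) :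
    JHom C n φ ∈ hypCycles C n := by
  rw [mem_symCycles] at h
  rw [mem_hypCycles, hypFlat_JHom, flatHypBnd_J, h, map_zero]

theorem JHom_mem_bdrys {n : ℤ} {φ : SymCh C n} (h : φ ∈ symBdrys C n) :
    JHom C n φ ∈ hypBdrys C n := by
  obtain ⟨ξ, hξ⟩ := (mem_symBdrys C rfl).1 h
  refine (mem_hypBdrys C rfl).2 ⟨JHom C _ ξ, ?_⟩
  rw [hypFlat_JHom, hypFlat_JHom, flatHypBnd_J, hξ]

theorem HHom_mem_cycles {n : ℤ} {θ : HypCh C n} (h : θ ∈ hypCycles C n) :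
    HHom C n θ ∈ quadCycles C (n - 1) := by
  rw [mem_hypCycles] at h
  rw [mem_quadCycles, quadFlat_HHom, ← flatH_hypBnd, h, map_zero]

theorem HHom_mem_bdrys {n : ℤ} {θ : HypCh C n} (h : θ ∈ hypBdrys C n) :
    HHom C n θ ∈ quadBdrys C (n - 1) := by
  obtain ⟨ν, hν⟩ := (mem_hypBdrys C rfl).1 h
  obtain ⟨χ, hχ⟩ := exists_quadFlat_eq_flatH C rfl ν
  refine (mem_quadBdrys C (sub_add_cancel n 1).symm).2 ⟨χ, ?_⟩
  rw [quadFlat_HHom, hχ, ← hν, flatH_hypBnd]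

section Subquotient

variable {G₁ G₂ G₃ : Type} [AddCommGroup G₁] [AddCommGroup G₂] [AddCommGroup G₃]

/-- The map of subquotients induced by a homomorphism. -/
def subquotientMap {Z₁ B₁ : AddSubgroup G₁} {Z₂ B₂ : AddSubgroup G₂} (f : G₁ →+ G₂)
    (hZ : ∀ {x}, x ∈ Z₁ → f x ∈ Z₂) (hB : ∀ {x}, x ∈ B₁ → f x ∈ B₂) :
    Z₁ ⧸ B₁.addSubgroupOf Z₁ →+ Z₂ ⧸ B₂.addSubgroupOf Z₂ :=
  QuotientAddGroup.map _ _ ((f.comp Z₁.subtype).codRestrict Z₂ fun x => hZ x.2)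
    fun _ hx => hB hx

theorem subquotientMap_exact {Z₁ B₁ : AddSubgroup G₁} {Z₂ B₂ : AddSubgroup G₂}
    {Z₃ B₃ : AddSubgroup G₃} {f : G₁ →+ G₂} {g : G₂ →+ G₃}
    (hfZ : ∀ {x}, x ∈ Z₁ → f x ∈ Z₂) (hfB : ∀ {x}, x ∈ B₁ → f x ∈ B₂)
    (hgZ : ∀ {x}, x ∈ Z₂ → g x ∈ Z₃) (hgB : ∀ {x}, x ∈ B₂ → g x ∈ B₃)
    (h₁ : ∀ x ∈ Z₁, g (f x) ∈ B₃)
    (h₂ : ∀ y ∈ Z₂, g y ∈ B₃ → ∃ x ∈ Z₁, y - f x ∈ B₂) :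
    Function.Exact (subquotientMap f hfZ hfB) (subquotientMap g hgZ hgB) := by
  intro y
  induction y using QuotientAddGroup.induction_on with
  | H y =>
    constructor
    · intro hy
      obtain ⟨x, hx, hxy⟩ := h₂ y y.2
        (AddSubgroup.mem_addSubgroupOf.1 ((QuotientAddGroup.eq_zero_iff (⟨g y, hgZ y.2⟩ : Z₃)).1 hy))
      refine ⟨QuotientAddGroup.mk ⟨x, hx⟩, QuotientAddGroup.eq.2 ?_⟩
      rw [AddSubgroup.mem_addSubgroupOf]
      rw [sub_eq_neg_add] at hxy
      exact hxy
    · rintro ⟨x, hx⟩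
      rw [← hx]
      induction x using QuotientAddGroup.induction_on with
      | H x => exact (QuotientAddGroup.eq_zero_iff _).2 (h₁ x x.2)

end Subquotient

theorem zsmul_esign_self {E : Type} [AddCommGroup E] (n : ℤ) (x : E) :
    esign n • esign n • x = x := by
  rw [smul_smul, esign_mul_self, one_smul]

theorem JHom_oneTHom_mem_bdrys {n : ℤ} {ψ : QuadCh C n} (h : ψ ∈ quadCycles C n) :
    JHom C n (oneTHom C n ψ) ∈ hypBdrys C n := by
  rw [mem_quadCycles] at h
  obtain ⟨ν, hν⟩ := exists_hypFlat_eq_flatK C rfl ψ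
  refine (mem_hypBdrys C rfl).2 ⟨esign n • ν, ?_⟩
  rw [map_zsmul, map_zsmul, hν, flatHypBnd_K, h, map_zero, zero_add, zsmul_esign_self,
    hypFlat_JHom, symFlat_oneTHom]

theorem exists_sub_oneTHom_mem_bdrys {n : ℤ} {φ : SymCh C n} (h : JHom C n φ ∈ hypBdrys C n) :
    ∃ ψ ∈ quadCycles C n, φ - oneTHom C n ψ ∈ symBdrys C n := by
  obtain ⟨ν, hν⟩ := (mem_hypBdrys C rfl).1 h
  rw [hypFlat_JHom] at hν
  obtain ⟨χ, hχ⟩ := exists_quadFlat_eq_flatH C rfl ν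
  obtain ⟨ξ, hξ⟩ := exists_symFlat_eq_flatR C ν
  have hR := congrArg (flatR _) hν
  have hH := congrArg (flatH _) hν
  rw [flatR_hypBnd, flatR_J, ← hχ, ← hξ] at hR
  rw [flatH_hypBnd, flatH_J, ← hχ] at hH
  refine ⟨esign n • χ, ?_, (mem_symBdrys C rfl).2 ⟨ξ, ?_⟩⟩
  · rw [mem_quadCycles, map_zsmul, map_zsmul, hH, smul_zero]
  · rw [map_sub, symFlat_oneTHom, map_zsmul, map_zsmul, ← hR, add_sub_cancel_right]

theorem HHom_JHom (n : ℤ) (φ : SymCh C n) : HHom C n (JHom C n φ) = 0 := by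
  apply quadFlat_injective
  rw [quadFlat_HHom, hypFlat_JHom, flatH_J, map_zero]

theorem exists_sub_JHom_mem_bdrys {n : ℤ} {θ : HypCh C n} (hθ : θ ∈ hypCycles C n)
    (h : HHom C n θ ∈ quadBdrys C (n - 1)) :
    ∃ φ ∈ symCycles C n, θ - JHom C n φ ∈ hypBdrys C n := by
  obtain ⟨χ, hχ⟩ := (mem_quadBdrys C (sub_add_cancel n 1).symm).1 h
  obtain ⟨ν, hν⟩ := exists_hypFlat_eq_flatK C rfl χ
  obtain ⟨φ, hφ⟩ := exists_symFlat_eq_flatR C θ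
  rw [quadFlat_HHom] at hχ
  rw [mem_hypCycles] at hθ
  have key : flatHypBnd C.totalD C.totalT n (hypFlat C (n + 1) ν) =
      hypFlat C n (θ - JHom C n (φ - esign n • oneTHom C n χ)) := by
    rw [hν, flatHypBnd_K, hχ]
    simp only [map_sub, map_zsmul, hypFlat_JHom, symFlat_oneTHom, hφ]
    nth_rw 2 [← flatJ_R_add_K_H (hypFlat C n θ)]
    abel
  refine ⟨φ - esign n • oneTHom C n χ, ?_, (mem_hypBdrys C rfl).2 ⟨ν, key⟩⟩
  have hb := congrArg (flatHypBnd C.totalD C.totalT (n - 1)) key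
  rw [flatHypBnd_hypBnd C.totalD_totalD C.totalT_totalT C.totalD_totalT, map_sub, map_sub, hθ,
    hypFlat_JHom, flatHypBnd_J, zero_sub, zero_eq_neg] at hb
  rw [mem_symCycles, ← flatR_J (flatSymBnd _ _ _ _), hb, map_zero]

theorem oneTHom_HHom_mem_bdrys {n : ℤ} {θ : HypCh C n} (h : θ ∈ hypCycles C n) :
    oneTHom C (n - 1) (HHom C n θ) ∈ symBdrys C (n - 1) := by
  rw [mem_hypCycles] at h
  obtain ⟨φ, hφ⟩ := exists_symFlat_eq_flatR C θ
  refine (mem_symBdrys C (sub_add_cancel n 1).symm).2 ⟨-(esign (n - 1) • φ), ?_⟩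
  have hR := congrArg (flatR _) h
  rw [flatR_hypBnd, map_zero, add_eq_zero_iff_eq_neg] at hR
  rw [map_neg, map_neg, map_zsmul, map_zsmul, hφ, hR, smul_neg, neg_neg, zsmul_esign_self,
    symFlat_oneTHom, quadFlat_HHom]

theorem exists_HHom_eq {n : ℤ} {ψ : QuadCh C (n - 1)} (hψ : ψ ∈ quadCycles C (n - 1))
    (h : oneTHom C (n - 1) ψ ∈ symBdrys C (n - 1)) :
    ∃ θ ∈ hypCycles C n, HHom C n θ = ψ := by
  obtain ⟨ξ, hξ⟩ := (mem_symBdrys C (sub_add_cancel n 1).symm).1 h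
  obtain ⟨ν, hν⟩ := exists_hypFlat_eq_flatK C (sub_add_cancel n 1).symm ψ
  rw [mem_quadCycles] at hψ
  rw [symFlat_oneTHom] at hξ
  refine ⟨ν - esign (n - 1) • JHom C n ξ, ?_, quadFlat_injective C _ ?_⟩
  · rw [mem_hypCycles]
    simp only [map_sub, map_zsmul, hν, hypFlat_JHom, flatHypBnd_K, flatHypBnd_J, hψ, hξ, map_zero,
      zero_add, sub_self]
  · rw [map_sub, map_zsmul, HHom_JHom, smul_zero, sub_zero, quadFlat_HHom, hν, flatH_K]

/-- For every finite-dimensional `A`-module chain complex `C`, the maps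
`1+T`, `J`, `H` are group homomorphisms and the sequence
`⋯ → Q_n(C) → Q^n(C) → Q̂^n(C) → Q_{n-1}(C) → ⋯` is exact at every term. -/
theorem stmt3 (A : Type) [Ring A] [StarRing A] (C : ChainCx A) :
    ∃ (tmap : ∀ n : ℤ, Qquad C n →+ Qsym C n)
      (jmap : ∀ n : ℤ, Qsym C n →+ Qhyp C n)
      (hmap : ∀ n : ℤ, Qhyp C n →+ Qquad C (n - 1)),
      (∀ (n : ℤ) (ψ : QuadCh C n) (h1 : IsQuadStr C n ψ)
          (h2 : IsSymStr C n (oneTchain C n ψ)),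
        tmap n (mkQuad C n ψ h1) = mkSym C n (oneTchain C n ψ) h2) ∧
      (∀ (n : ℤ) (φ : SymCh C n) (h1 : IsSymStr C n φ)
          (h2 : IsHypStr C n (Jchain C n φ)),
        jmap n (mkSym C n φ h1) = mkHyp C n (Jchain C n φ) h2) ∧
      (∀ (n : ℤ) (θ : HypCh C n) (h1 : IsHypStr C n θ)
          (h2 : IsQuadStr C (n - 1) (Hchain C n θ)),
        hmap n (mkHyp C n θ h1) = mkQuad C (n - 1) (Hchain C n θ) h2) ∧
      (∀ n : ℤ, Function.Exact (tmap n) (jmap n)) ∧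
      (∀ n : ℤ, Function.Exact (jmap n) (hmap n)) ∧
      (∀ n : ℤ, Function.Exact (hmap n) (tmap (n - 1))) := by
  refine ⟨fun n => subquotientMap (oneTHom C n) (oneTHom_mem_cycles C) (oneTHom_mem_bdrys C),
    fun n => subquotientMap (JHom C n) (JHom_mem_cycles C) (JHom_mem_bdrys C),
    fun n => subquotientMap (HHom C n) (HHom_mem_cycles C) (HHom_mem_bdrys C),
    fun _ _ _ _ => rfl, fun _ _ _ _ => rfl, fun _ _ _ _ => rfl, fun n => ?_, fun n => ?_,
    fun n => ?_⟩
  · exact subquotientMap_exact _ _ _ _ (fun _ => JHom_oneTHom_mem_bdrys C)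
      fun _ _ => exists_sub_oneTHom_mem_bdrys C
  · refine subquotientMap_exact _ _ _ _ (fun φ _ => ?_) fun _ => exists_sub_JHom_mem_bdrys C
    rw [HHom_JHom]
    exact zero_mem _
  · refine subquotientMap_exact _ _ _ _ (fun _ => oneTHom_HHom_mem_bdrys C) fun ψ hψ h => ?_
    obtain ⟨θ, hθ, rfl⟩ := exists_HHom_eq C hψ h
    refine ⟨θ, hθ, ?_⟩
    rw [sub_self]
    exact zero_mem _
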